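/- arXiv:1807.11831 — 10 statements merged into one kernel-verified Lean document; each statement's English description precedes it below -/
import Mathlib

section
/- Let a < b be real numbers, let 1 < α ≤ 2, and let h : [a,b] → ℝ be continuous. Define y : (a,b] → ℝ by y(t) = ∫_a^b G(t,s) h(s) ds. Then y satisfies the fractional differential equation D^α_a y(t) + h(t) = 0 for all t ∈ (a,b), together with the Robin boundary conditions lim_{t→a⁺} (I^{2−α}_a y(t) − D^{α−1}_a y(t)) = 0 and y(b) + D^{α−1}_a y(b) = 0. -/
open Real Set Filter MeasureTheory

/-- Riemann–Liouville fractional integral of order `ν` based at `a`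
(`I^0_a` is the identity). -/
noncomputable def RLint (a ν : ℝ) (y : ℝ → ℝ) (t : ℝ) : ℝ :=
  if ν = 0 then y t
  else (1 / Real.Gamma ν) * ∫ s in a..t, (t - s) ^ (ν - 1) * y s

/-- Riemann–Liouville fractional derivative of order `α` with `1 < α ≤ 2`:
`D^α_a y = (d²/dt²) I^{2-α}_a y`. -/
noncomputable def RLderivHigh (a α : ℝ) (y : ℝ → ℝ) (t : ℝ) : ℝ :=
  deriv (deriv (RLint a (2 - α) y)) t

/-- Riemann–Liouville fractional derivative of order `β` with `0 < β ≤ 1`: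
`D^β_a y = (d/dt) I^{1-β}_a y`. -/
noncomputable def RLderivLow (a β : ℝ) (y : ℝ → ℝ) (t : ℝ) : ℝ :=
  deriv (RLint a (1 - β) y) t

/-- The Green's function for the Robin fractional boundary value problem. -/
noncomputable def greenG (a b α t s : ℝ) : ℝ :=
  if t ≤ s then
    ((t - a) ^ (α - 1) + (α - 1) * (t - a) ^ (α - 2)) /
        ((b - a) ^ (α - 1) + (α - 1) * (b - a) ^ (α - 2) + Real.Gamma α) *
      ((b - s) ^ (α - 1) / Real.Gamma α + 1)
  else
    ((t - a) ^ (α - 1) + (α - 1) * (t - a) ^ (α - 2)) /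
        ((b - a) ^ (α - 1) + (α - 1) * (b - a) ^ (α - 2) + Real.Gamma α) *
      ((b - s) ^ (α - 1) / Real.Gamma α + 1) -
      (t - s) ^ (α - 1) / Real.Gamma α

/-- The two-parameter Mittag-Leffler function `E_{α,β}(x) = ∑ x^k / Γ(kα+β)`. -/
noncomputable def ML (α β x : ℝ) : ℝ := ∑' k : ℕ, x ^ k / Real.Gamma (k * α + β)


theorem aux_beta (p q u t : ℝ) (hp : 0 < p) (hq : 0 < q) (hut : u < t) :
    ∫ s in u..t, (t - s) ^ (p - 1) * (s - u) ^ (q - 1) =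
      (t - u) ^ (p + q - 1) * (Real.Gamma p * Real.Gamma q / Real.Gamma (p + q)) := by
  have hpos : 0 < t - u := sub_pos.2 hut
  have h1 : ∫ s in u..t, (t - s) ^ (p - 1) * (s - u) ^ (q - 1) =
      ∫ x in (0:ℝ)..(t - u), x ^ (q - 1) * ((t - u) - x) ^ (p - 1) := by
    have := intervalIntegral.integral_comp_sub_right (a := u) (b := t)
      (fun x => x ^ (q - 1) * ((t - u) - x) ^ (p - 1)) u
    rw [sub_self] at this
    rw [← this]
    apply intervalIntegral.integral_congr
    intro s _
    simp only
    rw [mul_comm]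
    congr 2
    ring
  rw [h1]
  have h2 := Complex.betaIntegral_scaled (q : ℂ) (p : ℂ) hpos
  rw [Complex.betaIntegral_eq_Gamma_mul_div _ _ (by simpa using hq) (by simpa using hp)] at h2
  have h3 : ∫ x in (0:ℝ)..(t - u), (x : ℂ) ^ ((q : ℂ) - 1) * (((t - u : ℝ) : ℂ) - x) ^ ((p : ℂ) - 1) =
      ((∫ x in (0:ℝ)..(t - u), x ^ (q - 1) * ((t - u) - x) ^ (p - 1) : ℝ) : ℂ) := by
    rw [← intervalIntegral.integral_ofReal]
    apply intervalIntegral.integral_congr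
    intro x hx
    rw [uIcc_of_le hpos.le] at hx
    simp only
    rw [Complex.ofReal_mul, Complex.ofReal_cpow hx.1, Complex.ofReal_cpow (sub_nonneg.2 hx.2)]
    push_cast
    rfl
  rw [h3] at h2
  have h4 : (((t - u) ^ (p + q - 1) * (Real.Gamma p * Real.Gamma q / Real.Gamma (p + q)) : ℝ) : ℂ)
      = ((t - u : ℝ) : ℂ) ^ ((q : ℂ) + p - 1) * (Complex.Gamma q * Complex.Gamma p / Complex.Gamma (q + p)) := by
    rw [Complex.ofReal_mul, Complex.ofReal_cpow hpos.le, ← Complex.ofReal_add, Complex.Gamma_ofReal,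
      Complex.Gamma_ofReal, Complex.Gamma_ofReal, add_comm q p, mul_comm (Real.Gamma q : ℂ)]
    push_cast
    rfl
  rw [← h4] at h2
  exact_mod_cast h2

theorem aux_beta_int (p q u t : ℝ) (hp : 0 < p) (hq : 0 < q) (hut : u < t) :
    IntervalIntegrable (fun s => (t - s) ^ (p - 1) * (s - u) ^ (q - 1)) volume u t := by
  apply intervalIntegral.intervalIntegrable_of_integral_ne_zero
  rw [aux_beta p q u t hp hq hut]
  have := Real.Gamma_pos_of_pos hp
  have := Real.Gamma_pos_of_pos hq
  have := Real.Gamma_pos_of_pos (add_pos hp hq)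
  have := Real.rpow_pos_of_pos (sub_pos.2 hut) (p + q - 1)
  positivity

theorem aux_int_left (p a t : ℝ) (hp : 0 < p) :
    IntervalIntegrable (fun s => (t - s) ^ (p - 1)) volume a t := by
  have h1 : IntervalIntegrable (fun x : ℝ => x ^ (p - 1)) volume (t - a) (t - t) :=
    intervalIntegral.intervalIntegrable_rpow' (by linarith)
  simpa using h1.comp_sub_left t

theorem aux_cont (α : ℝ) (hα : 1 < α) :
    Continuous (fun x : ℝ => max x 0 ^ (α - 1)) :=
  (continuous_id.max continuous_const).rpow_const (fun _ => Or.inr (by linarith))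

theorem aux_zero (α x : ℝ) (hα : 1 < α) (hx : x ≤ 0) : max x 0 ^ (α - 1) = 0 := by
  rw [max_eq_right hx, Real.zero_rpow (by linarith)]

theorem aux_kernel (α a t u : ℝ) (hα : 1 < α) (hα2 : α < 2) (hau : a ≤ u) (hat : a < t) :
    ∫ s in a..t, (t - s) ^ (2 - α - 1) * max (s - u) 0 ^ (α - 1) =
      Real.Gamma (2 - α) * Real.Gamma α * max (t - u) 0 := by
  have hz : ∀ c, a ≤ c → c ≤ u → ∫ s in a..c, (t - s) ^ (2 - α - 1) * max (s - u) 0 ^ (α - 1) = 0 := by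
    intro c hac hcu
    rw [intervalIntegral.integral_congr (g := fun _ => 0)]
    · simp
    · intro s hs
      rw [uIcc_of_le hac] at hs
      simp only
      rw [aux_zero α _ hα (by linarith [hs.2]), mul_zero]
  rcases le_or_gt t u with h | h
  · rw [hz t hat.le h, max_eq_right (by linarith), mul_zero]
  · have hi : IntervalIntegrable (fun s => (t - s) ^ (2 - α - 1) * max (s - u) 0 ^ (α - 1)) volume a t :=
      (aux_int_left (2 - α) a t (by linarith)).mul_continuousOn
        ((aux_cont α hα).comp (continuous_id.sub continuous_const)).continuousOn
    have hu : u ∈ uIcc a t := by rw [uIcc_of_le hat.le]; exact ⟨hau, h.le⟩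
    rw [← intervalIntegral.integral_add_adjacent_intervals (b := u)
      (hi.mono_set (uIcc_subset_uIcc left_mem_uIcc hu))
      (hi.mono_set (uIcc_subset_uIcc hu right_mem_uIcc)), hz u hau le_rfl, zero_add]
    have := aux_beta (2 - α) α u t (by linarith) (by linarith) h
    rw [show 2 - α + α = 2 by ring, show (2:ℝ) - 1 = 1 by norm_num, Real.rpow_one, Real.Gamma_two,
      div_one] at this
    rw [max_eq_left (by linarith), mul_comm _ (t - u), ← this]
    apply intervalIntegral.integral_congr
    intro s hs
    rw [uIcc_of_le h.le] at hs
    simp only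
    rw [max_eq_left (by linarith [hs.1])]

theorem aux_fubini (α a b t : ℝ) (g : ℝ → ℝ) (hg : Continuous g) (hα : 1 < α) (hα2 : α < 2)
    (hab : a < b) (hat : a < t) :
    IntervalIntegrable (fun s => (t - s) ^ (2 - α - 1) *
      ∫ u in a..b, max (s - u) 0 ^ (α - 1) * g u) volume a t ∧
    ∫ s in a..t, (t - s) ^ (2 - α - 1) * ∫ u in a..b, max (s - u) 0 ^ (α - 1) * g u =
      Real.Gamma (2 - α) * Real.Gamma α * ∫ u in a..b, max (t - u) 0 * g u := by
  constructor
  · apply (aux_int_left (2 - α) a t (by linarith)).mul_continuousOn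
    apply Continuous.continuousOn
    apply intervalIntegral.continuous_parametric_intervalIntegral_of_continuous'
    exact ((aux_cont α hα).comp (continuous_fst.sub continuous_snd)).mul (hg.comp continuous_snd)
  · simp_rw [← intervalIntegral.integral_const_mul]
    rw [intervalIntegral_intervalIntegral_swap]
    · apply intervalIntegral.integral_congr
      intro u hu
      rw [uIcc_of_le hab.le] at hu
      simp only
      rw [← mul_assoc, ← aux_kernel α a t u hα hα2 hu.1 hat, ← intervalIntegral.integral_mul_const]
      congr 1
      ext s
      ring
    · have h1 : IntegrableOn (fun s => (t - s) ^ (2 - α - 1)) (uIoc a t) :=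
        intervalIntegrable_iff.1 (aux_int_left (2 - α) a t (by linarith))
      have h2 : IntegrableOn g (uIoc a b) := intervalIntegrable_iff.1 (hg.intervalIntegrable a b)
      have h3 := Integrable.mul_prod h1 h2
      rw [Measure.prod_restrict] at h3
      have h4 := Integrable.bdd_mul (c := (t - a) ^ (α - 1)) (f := fun z : ℝ × ℝ => max (z.1 - z.2) 0 ^ (α - 1)) h3
        (((aux_cont α hα).comp (continuous_fst.sub continuous_snd)).aestronglyMeasurable) (by
          refine (ae_restrict_iff' (measurableSet_uIoc.prod measurableSet_uIoc)).2 (ae_of_all _ ?_)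
          rintro ⟨s, u⟩ ⟨hs, hu⟩
          rw [uIoc_of_le hat.le] at hs
          rw [uIoc_of_le hab.le] at hu
          simp only at hs hu ⊢
          rw [Real.norm_of_nonneg (by positivity)]
          apply Real.rpow_le_rpow (le_max_right _ _) _ (by linarith)
          exact max_le (by linarith [hs.2, hu.1]) (by linarith))
      refine h4.congr (ae_of_all _ ?_)
      rintro ⟨s, u⟩
      simp only [Function.uncurry]
      ring

theorem aux_F_left (a t : ℝ) (g : ℝ → ℝ) (hg : Continuous g) :
    HasDerivAt (fun t => ∫ u in a..t, (t - u) * g u) (∫ u in a..t, g u) t := by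
  have e : (fun t => ∫ u in a..t, (t - u) * g u) =
      fun t => t * (∫ u in a..t, g u) - ∫ u in a..t, u * g u := by
    ext t
    rw [← intervalIntegral.integral_const_mul, ← intervalIntegral.integral_sub]
    · congr 1
      ext u
      ring
    · exact (continuous_const.mul hg).intervalIntegrable _ _
    · exact (continuous_id.mul hg).intervalIntegrable _ _
  rw [e]
  have h1 := (hasDerivAt_id t).mul (hg.integral_hasStrictDerivAt a t).hasDerivAt
  have h2 := ((continuous_id.mul hg).integral_hasStrictDerivAt a t).hasDerivAt
  have h3 := h1.sub h2
  simp only [id, one_mul, Pi.mul_apply, add_sub_cancel_right] at h3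
  exact h3

theorem aux_F_eq (a b t : ℝ) (g : ℝ → ℝ) (hg : Continuous g) (hat : a ≤ t) (htb : t ≤ b) :
    ∫ u in a..b, max (t - u) 0 * g u = ∫ u in a..t, (t - u) * g u := by
  have hc : Continuous (fun u => max (t - u) 0 * g u) := by fun_prop
  rw [← intervalIntegral.integral_add_adjacent_intervals (b := t)
      (hc.intervalIntegrable _ _) (hc.intervalIntegrable _ _)]
  have h1 : ∫ u in t..b, max (t - u) 0 * g u = 0 := by
    rw [intervalIntegral.integral_congr (g := fun _ => 0)]
    · simp
    · intro s hs
      rw [uIcc_of_le htb] at hs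
      simp only
      rw [max_eq_right (by linarith [hs.1]), zero_mul]
  rw [h1, add_zero]
  apply intervalIntegral.integral_congr
  intro s hs
  rw [uIcc_of_le hat] at hs
  simp only
  rw [max_eq_left (by linarith [hs.2])]

theorem aux_F (a b t : ℝ) (g : ℝ → ℝ) (hg : Continuous g) (hat : a < t) (htb : t ≤ b) :
    HasDerivAt (fun t => ∫ u in a..b, max (t - u) 0 * g u) (∫ u in a..t, g u) t := by
  have hev : ∀ᶠ x in nhds t, a < x := lt_mem_nhds hat
  have hl := aux_F_left a t g hg
  rcases htb.lt_or_eq with h | h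
  · refine hl.congr_of_eventuallyEq ?_
    filter_upwards [hev, gt_mem_nhds h] with x h1 h2
    exact aux_F_eq a b x g hg h1.le h2.le
  · subst h
    have L : HasDerivWithinAt (fun x => ∫ u in a..t, max (x - u) 0 * g u) (∫ u in a..t, g u)
        (Iic t) t := by
      refine hl.hasDerivWithinAt.congr_of_eventuallyEq ?_ (aux_F_eq a t t g hg hat.le le_rfl)
      filter_upwards [self_mem_nhdsWithin, nhdsWithin_le_nhds hev] with x h1 h2
      exact aux_F_eq a t x g hg h2.le h1
    have e : ∀ x ∈ Ici t, ∫ u in a..t, max (x - u) 0 * g u =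
        x * (∫ u in a..t, g u) - ∫ u in a..t, u * g u := by
      intro x hx
      rw [← intervalIntegral.integral_const_mul, ← intervalIntegral.integral_sub]
      · apply intervalIntegral.integral_congr
        intro s hs
        rw [uIcc_of_le hat.le] at hs
        simp only
        rw [max_eq_left (by linarith [hs.2, mem_Ici.1 hx])]
        ring
      · exact (continuous_const.mul hg).intervalIntegrable _ _
      · exact (continuous_id.mul hg).intervalIntegrable _ _
    have R : HasDerivWithinAt (fun x => ∫ u in a..t, max (x - u) 0 * g u) (∫ u in a..t, g u)
        (Ici t) t := by
      have h1 := ((hasDerivAt_id t).mul_const (∫ u in a..t, g u)).sub_const (∫ u in a..t, u * g u)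
      rw [one_mul] at h1
      exact h1.hasDerivWithinAt.congr e (e t self_mem_Ici)
    have := L.union R
    rwa [Iic_union_Ici, hasDerivWithinAt_univ] at this

theorem aux_RL (a b α : ℝ) (hab : a < b) (hα1 : 1 < α) (hα2 : α ≤ 2) (g : ℝ → ℝ)
    (hg : Continuous g) (y : ℝ → ℝ) (c : ℝ)
    (hy : ∀ t, a < t → y t = c * ((t - a) ^ (α - 1) + (α - 1) * (t - a) ^ (α - 2)) -
      (1 / Real.Gamma α) * ∫ u in a..b, max (t - u) 0 ^ (α - 1) * g u) (t : ℝ) (hat : a < t) :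
    RLint a (2 - α) y t = c * Real.Gamma α * (t - a + 1) - ∫ u in a..b, max (t - u) 0 * g u := by
  rcases hα2.lt_or_eq with h | h
  · have hGa := (Real.Gamma_pos_of_pos (show 0 < α by linarith)).ne'
    have hG2 := (Real.Gamma_pos_of_pos (show 0 < 2 - α by linarith)).ne'
    obtain ⟨i3, e3⟩ := aux_fubini α a b t g hg hα1 h hab hat
    have i1 := aux_beta_int (2 - α) α a t (by linarith) (by linarith) hat
    have e1 := aux_beta (2 - α) α a t (by linarith) (by linarith) hat
    have i2 := aux_beta_int (2 - α) (α - 1) a t (by linarith) (by linarith) hat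
    have e2 := aux_beta (2 - α) (α - 1) a t (by linarith) (by linarith) hat
    rw [show 2 - α + α = 2 by ring, show (2:ℝ) - 1 = 1 by norm_num, Real.rpow_one, Real.Gamma_two,
      div_one] at e1
    rw [show 2 - α + (α - 1) = 1 by ring, sub_self, Real.rpow_zero, Real.Gamma_one,
      div_one, one_mul] at e2
    have hGam : (α - 1) * Real.Gamma (α - 1) = Real.Gamma α := by
      rw [← Real.Gamma_add_one (by linarith), sub_add_cancel]
    have key : ∫ s in a..t, (t - s) ^ (2 - α - 1) * y s =
        ∫ s in a..t, ((c * ((t - s) ^ (2 - α - 1) * (s - a) ^ (α - 1)) +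
          (c * (α - 1)) * ((t - s) ^ (2 - α - 1) * (s - a) ^ (α - 1 - 1))) -
          (1 / Real.Gamma α) * ((t - s) ^ (2 - α - 1) *
            ∫ u in a..b, max (s - u) 0 ^ (α - 1) * g u)) := by
      apply intervalIntegral.integral_congr_ae
      refine ae_of_all _ ?_
      intro s hs
      rw [uIoc_of_le hat.le] at hs
      rw [hy s hs.1, show α - 1 - 1 = α - 2 by ring]
      ring
    rw [RLint, if_neg (by linarith), key, intervalIntegral.integral_sub
      ((i1.const_mul _).add (i2.const_mul _)) (i3.const_mul _),
      intervalIntegral.integral_add (i1.const_mul _) (i2.const_mul _),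
      intervalIntegral.integral_const_mul, intervalIntegral.integral_const_mul,
      intervalIntegral.integral_const_mul, e1, e2, e3, ← hGam]
    rw [← hGam] at hGa
    have h5 : Real.Gamma (α - 1) ≠ 0 := right_ne_zero_of_mul hGa
    have h6 : α - 1 ≠ 0 := left_ne_zero_of_mul hGa
    field_simp
  · subst h
    rw [RLint, if_pos (by norm_num), hy t hat]
    norm_num

theorem stmt0 (a b α : ℝ) (hab : a < b) (hα1 : 1 < α) (hα2 : α ≤ 2)
    (h : ℝ → ℝ) (hc : ContinuousOn h (Set.Icc a b))
    (y : ℝ → ℝ) (hy : ∀ t, y t = ∫ s in a..b, greenG a b α t s * h s) :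
    (∀ t ∈ Set.Ioo a b, RLderivHigh a α y t + h t = 0) ∧
    Filter.Tendsto (fun t => RLint a (2 - α) y t - RLderivLow a (α - 1) y t)
      (nhdsWithin a (Set.Ioi a)) (nhds 0) ∧
    y b + RLderivLow a (α - 1) y b = 0 := by
  set g : ℝ → ℝ := IccExtend hab.le (domRestrict (Icc a b) h) with hgdef
  have hg : Continuous g := hc.domRestrict.Icc_extend'
  have hgh : ∀ s ∈ Icc a b, g s = h s := by
    intro s hs
    rw [hgdef, IccExtend_of_mem _ _ hs]
    rfl
  have hGa := Real.Gamma_pos_of_pos (show 0 < α by linarith)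
  set A := (b - a) ^ (α - 1) + (α - 1) * (b - a) ^ (α - 2) + Real.Gamma α with hA
  have hApos : 0 < A := by
    have h1 := Real.rpow_pos_of_pos (sub_pos.2 hab) (α - 1)
    have h2 := Real.rpow_pos_of_pos (sub_pos.2 hab) (α - 2)
    have h3 : 0 < α - 1 := by linarith
    positivity
  set W := ∫ s in a..b, ((1 / Real.Gamma α) * (max (b - s) 0 ^ (α - 1) * g s) + g s) with hW
  have hcm : ∀ t, Continuous fun s => max (t - s) 0 ^ (α - 1) * g s := fun t =>
    ((aux_cont α hα1).comp (continuous_const.sub continuous_id)).mul hg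
  have hWe : W = (1 / Real.Gamma α) * (∫ s in a..b, max (b - s) 0 ^ (α - 1) * g s) +
      ∫ s in a..b, g s := by
    rw [hW, intervalIntegral.integral_add (((hcm b).intervalIntegrable _ _).const_mul _)
      (hg.intervalIntegrable _ _), intervalIntegral.integral_const_mul]
  have hyf : ∀ t, a < t → y t = (W / A) * ((t - a) ^ (α - 1) + (α - 1) * (t - a) ^ (α - 2)) -
      (1 / Real.Gamma α) * ∫ u in a..b, max (t - u) 0 ^ (α - 1) * g u := by
    intro t hat
    have e : y t = ∫ s in a..b,
        ((((t - a) ^ (α - 1) + (α - 1) * (t - a) ^ (α - 2)) / A) *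
          ((1 / Real.Gamma α) * (max (b - s) 0 ^ (α - 1) * g s) + g s) -
          (1 / Real.Gamma α) * (max (t - s) 0 ^ (α - 1) * g s)) := by
      rw [hy t]
      apply intervalIntegral.integral_congr
      intro s hs
      rw [uIcc_of_le hab.le] at hs
      simp only [greenG]
      rw [hgh s hs, max_eq_left (show 0 ≤ b - s by linarith [hs.2])]
      split_ifs with hts
      · rw [aux_zero α _ hα1 (by linarith)]
        ring
      · rw [max_eq_left (by linarith)]
        ring
    rw [e, intervalIntegral.integral_sub, intervalIntegral.integral_const_mul,
      intervalIntegral.integral_const_mul, ← hW]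
    · ring
    · exact (continuous_const.mul ((continuous_const.mul (hcm b)).add hg)).intervalIntegrable _ _
    · exact (continuous_const.mul (hcm t)).intervalIntegrable _ _
  have hRL := aux_RL a b α hab hα1 hα2 g hg y (W / A) hyf
  have hD : ∀ t, a < t → t ≤ b → HasDerivAt (RLint a (2 - α) y)
      (W / A * Real.Gamma α - ∫ u in a..t, g u) t := by
    intro t hat htb
    have h1 := (((hasDerivAt_id t).sub_const a).add_const 1).const_mul (W / A * Real.Gamma α)
    have h2 := h1.sub (aux_F a b t g hg hat htb)
    rw [mul_one] at h2
    refine h2.congr_of_eventuallyEq ?_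
    filter_upwards [lt_mem_nhds hat] with x hx
    exact hRL x hx
  have hlow : ∀ t, a < t → t ≤ b → RLderivLow a (α - 1) y t =
      W / A * Real.Gamma α - ∫ u in a..t, g u := by
    intro t hat htb
    rw [RLderivLow, show 1 - (α - 1) = 2 - α by ring]
    exact (hD t hat htb).deriv
  refine ⟨?_, ?_, ?_⟩
  · intro t ht
    rw [RLderivHigh]
    have h1 : deriv (RLint a (2 - α) y) =ᶠ[nhds t]
        fun t => W / A * Real.Gamma α - ∫ u in a..t, g u := by
      filter_upwards [Ioo_mem_nhds ht.1 ht.2] with x hx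
      exact (hD x hx.1 hx.2.le).deriv
    rw [h1.deriv_eq, (((hg.integral_hasStrictDerivAt a t).hasDerivAt).const_sub _).deriv,
      hgh t ⟨ht.1.le, ht.2.le⟩]
    ring
  · have e : (fun t => W / A * Real.Gamma α * (t - a) - (∫ u in a..t, (t - u) * g u) +
        ∫ u in a..t, g u) =ᶠ[nhdsWithin a (Ioi a)]
        (fun t => RLint a (2 - α) y t - RLderivLow a (α - 1) y t) := by
      filter_upwards [self_mem_nhdsWithin, nhdsWithin_le_nhds (gt_mem_nhds hab)] with x h1 h2
      rw [hRL x h1, hlow x h1 (le_of_lt h2), aux_F_eq a b x g hg (le_of_lt h1) (le_of_lt h2)]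
      ring
    refine Tendsto.congr' e ?_
    have hcont : ContinuousAt (fun t => W / A * Real.Gamma α * (t - a) -
        (∫ u in a..t, (t - u) * g u) + ∫ u in a..t, g u) a :=
      ((continuousAt_const.mul (continuousAt_id.sub continuousAt_const)).sub
        (aux_F_left a a g hg).continuousAt).add
        (hg.integral_hasStrictDerivAt a a).hasDerivAt.continuousAt
    have := hcont.tendsto
    simp only [sub_self, mul_zero, intervalIntegral.integral_same, add_zero] at this
    exact this.mono_left nhdsWithin_le_nhds
  · rw [hlow b hab le_rfl, hyf b hab]
    have h1 : W / A * A = W := div_mul_cancel₀ _ hApos.ne'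
    have h2 : W / A * ((b - a) ^ (α - 1) + (α - 1) * (b - a) ^ (α - 2)) + W / A * Real.Gamma α = W := by
      rw [← mul_add, ← hA, h1]
    linarith
end

section
/- Let a < b be real numbers and let 1 < α ≤ 2. Then the Green's function G satisfies G(t,s) > 0 for all (t,s) ∈ (a,b] × (a,b]. -/
open Real Set Filter MeasureTheory

theorem stmt2 (a b α : ℝ) (hab : a < b) (hα1 : 1 < α) (hα2 : α ≤ 2) :
    ∀ t ∈ Set.Ioc a b, ∀ s ∈ Set.Ioc a b, 0 < greenG a b α t s := by
  rintro t ⟨hat, htb⟩ s ⟨has, hsb⟩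
  have hG : 0 < Real.Gamma α := Real.Gamma_pos_of_pos (by linarith)
  have hγ : 0 < α - 1 := by linarith
  have hT : 0 < t - a := by linarith
  have hB : 0 < b - a := by linarith
  have hT1 : 0 < (t - a) ^ (α - 1) := Real.rpow_pos_of_pos hT _
  have hT2 : 0 < (t - a) ^ (α - 2) := Real.rpow_pos_of_pos hT _
  have hB1 : 0 < (b - a) ^ (α - 1) := Real.rpow_pos_of_pos hB _
  have hB2 : 0 < (b - a) ^ (α - 2) := Real.rpow_pos_of_pos hB _
  have hBS : 0 ≤ (b - s) ^ (α - 1) := Real.rpow_nonneg (by linarith) _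
  have hA : 0 < (b - a) ^ (α - 1) + (α - 1) * (b - a) ^ (α - 2) + Real.Gamma α := by positivity
  unfold greenG
  split_ifs with hts
  · positivity
  · have hst : s < t := not_le.mp hts
    have hTS : 0 < (t - s) ^ (α - 1) := Real.rpow_pos_of_pos (by linarith) _
    have h1 : (t - s) ^ (α - 1) ≤ (t - a) ^ (α - 1) :=
      Real.rpow_le_rpow (by linarith) (by linarith) hγ.le
    have h2 : (t - s) ^ (α - 1) ≤ (b - s) ^ (α - 1) :=
      Real.rpow_le_rpow (by linarith) (by linarith) hγ.le
    have h3 : (b - a) ^ (α - 2) ≤ (t - a) ^ (α - 2) :=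
      Real.rpow_le_rpow_of_nonpos hT (by linarith) (by linarith)
    have h4 : (t - s) ^ (α - 1) * (b - a) ^ (α - 1) ≤ (t - a) ^ (α - 1) * (b - s) ^ (α - 1) := by
      rw [← Real.mul_rpow (by linarith) hB.le, ← Real.mul_rpow hT.le (by linarith)]
      refine Real.rpow_le_rpow (mul_nonneg (by linarith) hB.le) ?_ hγ.le
      nlinarith [mul_nonneg (sub_nonneg.2 has.le) (sub_nonneg.2 htb)]
    have h5 : (t - s) ^ (α - 1) * (b - a) ^ (α - 2) ≤ (b - s) ^ (α - 1) * (t - a) ^ (α - 2) :=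
      mul_le_mul h2 h3 hB2.le hBS
    have h6 := mul_le_mul_of_nonneg_left h5 hγ.le
    have h7 := mul_le_mul_of_nonneg_right h1 hG.le
    have h8 : 0 < (α - 1) * (t - a) ^ (α - 2) * Real.Gamma α := by positivity
    generalize (t - s) ^ (α - 1) = x1 at *
    generalize (b - s) ^ (α - 1) = x2 at *
    generalize (t - a) ^ (α - 1) = x3 at *
    generalize (t - a) ^ (α - 2) = x4 at *
    generalize (b - a) ^ (α - 1) = x5 at *
    generalize (b - a) ^ (α - 2) = x6 at *
    generalize Real.Gamma α = g at *
    have e : (x3 + (α - 1) * x4) / (x5 + (α - 1) * x6 + g) * (x2 / g + 1) - x1 / g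
        = ((x3 + (α - 1) * x4) * (x2 + g) - x1 * (x5 + (α - 1) * x6 + g)) /
          ((x5 + (α - 1) * x6 + g) * g) := by
      have := hA.ne'
      have := hG.ne'
      field_simp
    rw [e]
    apply div_pos _ (mul_pos hA hG)
    linarith
end

section
/- Let a < b be real numbers and let 1 < α ≤ 2. Then for all t, s ∈ (a,b], G(t,s) ≤ G(t,t); that is, for each fixed t the Green's function attains its maximum over s on the diagonal. -/
open Real Set Filter MeasureTheory

theorem stmt3 (a b α : ℝ) (hab : a < b) (hα1 : 1 < α) (hα2 : α ≤ 2) :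
    ∀ t ∈ Set.Ioc a b, ∀ s ∈ Set.Ioc a b, greenG a b α t s ≤ greenG a b α t t := by
  intro t ht s hs
  obtain ⟨hat, htb⟩ := ht
  obtain ⟨has, hsb⟩ := hs
  have hΓ : 0 < Real.Gamma α := Real.Gamma_pos_of_pos (by linarith)
  have hτ : 0 < t - a := by linarith
  have hL : 0 < b - a := by linarith
  have hp : 0 < α - 1 := by linarith
  have hN : 0 < (t - a) ^ (α - 1) + (α - 1) * (t - a) ^ (α - 2) := by positivity
  have hD : 0 < (b - a) ^ (α - 1) + (α - 1) * (b - a) ^ (α - 2) + Real.Gamma α := by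
    positivity
  unfold greenG
  rw [if_pos (le_refl t)]
  split_ifs with hts
  · have : (b - s) ^ (α - 1) ≤ (b - t) ^ (α - 1) :=
      Real.rpow_le_rpow (by linarith) (by linarith) hp.le
    gcongr
  · push Not at hts
    have hu : 0 < t - s := by linarith
    have hV : 0 < b - s := by linarith
    have e : ∀ x : ℝ, 0 < x → x ^ (α - 1) = x * x ^ (α - 2) := by
      intro x hx
      rw [show α - 1 = 1 + (α - 2) by ring, Real.rpow_add hx, Real.rpow_one]
    have h1 : (b - s) ^ (α - 1) - (b - t) ^ (α - 1) ≤ (t - s) * (b - s) ^ (α - 2) := by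
      rw [e _ hV]
      rcases htb.eq_or_lt with h | h
      · subst h
        rw [sub_self, Real.zero_rpow hp.ne']
        simp
      · have hw : 0 < b - t := by linarith
        rw [e _ hw]
        have : (b - s) ^ (α - 2) ≤ (b - t) ^ (α - 2) :=
          Real.rpow_le_rpow_of_nonpos hw (by linarith) (by linarith)
        nlinarith
    have h2 : (b - s) ^ (α - 2) * (t - a) ^ (α - 2) ≤ (t - s) ^ (α - 2) * (b - a) ^ (α - 2) := by
      rw [← Real.mul_rpow hV.le hτ.le, ← Real.mul_rpow hu.le hL.le]
      exact Real.rpow_le_rpow_of_nonpos (by positivity) (by nlinarith) (by linarith)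
    have h3 : ((t - a) ^ (α - 1) + (α - 1) * (t - a) ^ (α - 2)) *
        ((b - s) ^ (α - 1) - (b - t) ^ (α - 1)) ≤
        (t - s) ^ (α - 1) *
          ((b - a) ^ (α - 1) + (α - 1) * (b - a) ^ (α - 2) + Real.Gamma α) := by
      calc _ ≤ ((t - a) ^ (α - 1) + (α - 1) * (t - a) ^ (α - 2)) *
            ((t - s) * (b - s) ^ (α - 2)) := by gcongr
        _ = (t - a + (α - 1)) * (t - s) * ((b - s) ^ (α - 2) * (t - a) ^ (α - 2)) := by
            rw [e _ hτ]; ring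
        _ ≤ (b - a + (α - 1)) * (t - s) * ((t - s) ^ (α - 2) * (b - a) ^ (α - 2)) := by
            gcongr
        _ = (t - s) ^ (α - 1) * ((b - a) ^ (α - 1) + (α - 1) * (b - a) ^ (α - 2)) := by
            rw [e _ hu, e _ hL]; ring
        _ ≤ _ := by
            exact mul_le_mul_of_nonneg_left (by linarith) (Real.rpow_nonneg hu.le _)
    rw [← sub_nonneg]
    have key : ∀ N D g V w u : ℝ, 0 < D → 0 < g → N * (V - w) ≤ u * D →
        0 ≤ N / D * (w / g + 1) - (N / D * (V / g + 1) - u / g) := by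
      intro N D g V w u hD hg h
      have : N / D * (w / g + 1) - (N / D * (V / g + 1) - u / g)
          = (u * D - N * (V - w)) / (D * g) := by
        field_simp
        ring
      rw [this]
      apply div_nonneg (by linarith) (by positivity)
    exact key _ _ _ _ _ _ hD hΓ h3
end

section
/- Let a < b be real numbers and let 1 < α ≤ 2. Then for every t ∈ (a,b], ∫_a^b (t−a)^{2−α} G(t,s) ds = ((t−a+α−1)/A) · ((b−a)^α/Γ(α+1) + (b−a)) − (t−a)²/Γ(α+1). -/
open Real Set Filter MeasureTheory

theorem aux_int (a c α : ℝ) (hα1 : 1 < α) (hac : a ≤ c) :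
    (∫ s in a..c, (c - s) ^ (α - 1)) = (c - a) ^ α / α := by
  rw [intervalIntegral.integral_comp_sub_left (fun x => x ^ (α - 1)) c,
    integral_rpow (Or.inl (by linarith))]
  rw [sub_self, sub_add_cancel, Real.zero_rpow (by linarith), sub_zero]

theorem stmt5 (a b α : ℝ) (hab : a < b) (hα1 : 1 < α) (hα2 : α ≤ 2) :
    ∀ t ∈ Set.Ioc a b,
      (∫ s in a..b, (t - a) ^ (2 - α) * greenG a b α t s) =
        (t - a + α - 1) /
            ((b - a) ^ (α - 1) + (α - 1) * (b - a) ^ (α - 2) + Real.Gamma α) *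
          ((b - a) ^ α / Real.Gamma (α + 1) + (b - a)) -
        (t - a) ^ 2 / Real.Gamma (α + 1) := by
  rintro t ⟨hat, htb⟩
  have hG : 0 < Real.Gamma α := Real.Gamma_pos_of_pos (by linarith)
  have hG1 : Real.Gamma (α + 1) = α * Real.Gamma α := Real.Gamma_add_one (by linarith)
  have hta : 0 < t - a := by linarith
  have hba : 0 < b - a := by linarith
  have hA : 0 < (b - a) ^ (α - 1) + (α - 1) * (b - a) ^ (α - 2) + Real.Gamma α := by
    have h1 : 0 < α - 1 := by linarith
    positivity
  have hrw : ∀ s, (t - a) ^ (2 - α) * greenG a b α t s =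
      (t - a + α - 1) / ((b - a) ^ (α - 1) + (α - 1) * (b - a) ^ (α - 2) + Real.Gamma α) *
        ((b - s) ^ (α - 1) / Real.Gamma α + 1) -
      (t - a) ^ (2 - α) / Real.Gamma α * (max (t - s) 0) ^ (α - 1) := by
    intro s
    have e1 : (t - a) ^ (2 - α) * (t - a) ^ (α - 1) = t - a := by
      rw [← Real.rpow_add hta]; ring_nf; exact Real.rpow_one _
    have e2 : (t - a) ^ (2 - α) * (t - a) ^ (α - 2) = 1 := by
      rw [← Real.rpow_add hta]; ring_nf; exact Real.rpow_zero _
    have e3 : t - a + α - 1 = (t - a) ^ (2 - α) *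
        ((t - a) ^ (α - 1) + (α - 1) * (t - a) ^ (α - 2)) := by
      linear_combination -e1 - (α - 1) * e2
    rw [e3]
    unfold greenG
    split_ifs with h
    · rw [max_eq_right (by linarith), Real.zero_rpow (by linarith)]
      ring
    · rw [max_eq_left (by linarith)]
      ring
  have c1 : Continuous fun s : ℝ => (b - s) ^ (α - 1) :=
    (continuous_const.sub continuous_id).rpow_const fun _ => Or.inr (by linarith)
  have c2 : Continuous fun s : ℝ => (max (t - s) 0) ^ (α - 1) :=
    ((continuous_const.sub continuous_id).max continuous_const).rpow_const
      fun _ => Or.inr (by linarith)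
  have i2 : (∫ s in a..b, (max (t - s) 0) ^ (α - 1)) = (t - a) ^ α / α := by
    rw [← intervalIntegral.integral_add_adjacent_intervals
      (c2.intervalIntegrable a t) (c2.intervalIntegrable t b), ← aux_int a t α hα1 hat.le]
    have z : (∫ s in t..b, (max (t - s) 0) ^ (α - 1)) = ∫ s in t..b, (0 : ℝ) := by
      apply intervalIntegral.integral_congr
      intro s hs
      rw [uIcc_of_le htb] at hs
      simp only
      rw [max_eq_right (by linarith [hs.1]), Real.zero_rpow (by linarith)]
    rw [z, intervalIntegral.integral_zero, add_zero]
    apply intervalIntegral.integral_congr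
    intro s hs
    rw [uIcc_of_le hat.le] at hs
    simp only
    rw [max_eq_left (by linarith [hs.2])]
  simp_rw [hrw]
  rw [intervalIntegral.integral_sub
      (Continuous.intervalIntegrable (by fun_prop) _ _)
      (Continuous.intervalIntegrable (by fun_prop) _ _),
    intervalIntegral.integral_const_mul, intervalIntegral.integral_const_mul,
    intervalIntegral.integral_add
      (Continuous.intervalIntegrable (by fun_prop) _ _)
      (Continuous.intervalIntegrable (by fun_prop) _ _),
    intervalIntegral.integral_div, aux_int a b α hα1 hab.le, i2, hG1]
  have e4 : (t - a) ^ (2 - α) * (t - a) ^ α = (t - a) ^ 2 := by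
    rw [← Real.rpow_add hta, sub_add_cancel]; exact Real.rpow_two _
  rw [← e4]
  simp only [intervalIntegral.integral_const, smul_eq_mul, mul_one]
  have : α ≠ 0 := by linarith
  rw [div_div]
  congr 1
  field_simp
end

section
/- Let a < b be real numbers and let 1 < α ≤ 2. Then for every t ∈ (a,b], ∫_a^b (t−a)^{2−α} G(t,s) ds ≤ ((b−a+α−1)/A) · ((b−a)^α/Γ(α+1) + (b−a)). -/
open Real Set Filter MeasureTheory

theorem stmt6 (a b α : ℝ) (hab : a < b) (hα1 : 1 < α) (hα2 : α ≤ 2) :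
    ∀ t ∈ Set.Ioc a b,
      (∫ s in a..b, (t - a) ^ (2 - α) * greenG a b α t s) ≤
        (b - a + α - 1) /
            ((b - a) ^ (α - 1) + (α - 1) * (b - a) ^ (α - 2) + Real.Gamma α) *
          ((b - a) ^ α / Real.Gamma (α + 1) + (b - a)) := by
  intro t ht
  obtain ⟨hat, htb⟩ := ht
  have hA : 0 < (b - a) ^ (α - 1) + (α - 1) * (b - a) ^ (α - 2) + Real.Gamma α := by
    have h1 : 0 < (b - a) ^ (α - 1) := Real.rpow_pos_of_pos (by linarith) _
    have h2 : 0 < (b - a) ^ (α - 2) := Real.rpow_pos_of_pos (by linarith) _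
    have h3 : 0 < Real.Gamma α := Real.Gamma_pos_of_pos (by linarith)
    have h4 : 0 < (α - 1) * (b - a) ^ (α - 2) := mul_pos (by linarith) h2
    linarith
  have hG : 0 < Real.Gamma α := Real.Gamma_pos_of_pos (by linarith)
  have hta : 0 < t - a := by linarith
  have hα0 : 0 < α - 1 := by linarith
  set A := (b - a) ^ (α - 1) + (α - 1) * (b - a) ^ (α - 2) + Real.Gamma α with hAdef
  have hgreen : ∀ s, greenG a b α t s =
      ((t - a) ^ (α - 1) + (α - 1) * (t - a) ^ (α - 2)) / A *
        ((b - s) ^ (α - 1) / Real.Gamma α + 1) - (max (t - s) 0) ^ (α - 1) / Real.Gamma α := by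
    intro s
    unfold greenG
    split_ifs with h
    · rw [max_eq_right (by linarith), Real.zero_rpow hα0.ne']
      simp [hAdef]
    · rw [max_eq_left (by linarith)]
  have hmul : (t - a) ^ (2 - α) * ((t - a) ^ (α - 1) + (α - 1) * (t - a) ^ (α - 2))
      = t - a + (α - 1) := by
    have e1 : (t - a) ^ (2 - α) * (t - a) ^ (α - 1) = t - a := by
      rw [← Real.rpow_add hta]
      ring_nf
      simp
    have e2 : (t - a) ^ (2 - α) * (t - a) ^ (α - 2) = 1 := by
      rw [← Real.rpow_add hta]
      ring_nf
      simp
    linear_combination e1 + (α - 1) * e2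
  have hcont1 : Continuous fun s : ℝ => (b - s) ^ (α - 1) :=
    (continuous_const.sub continuous_id).rpow_const (fun _ => Or.inr hα0.le)
  have hcont2 : Continuous fun s : ℝ => (max (t - s) 0) ^ (α - 1) :=
    ((continuous_const.sub continuous_id).max continuous_const).rpow_const
      (fun _ => Or.inr hα0.le)
  have hint : ∫ s in a..b, (b - a + α - 1) / A * ((b - s) ^ (α - 1) / Real.Gamma α + 1)
      = (b - a + α - 1) / A * ((b - a) ^ α / Real.Gamma (α + 1) + (b - a)) := by
    rw [intervalIntegral.integral_const_mul, intervalIntegral.integral_add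
      ((hcont1.div_const _).intervalIntegrable _ _) (by simp),
      intervalIntegral.integral_div,
      intervalIntegral.integral_comp_sub_left (fun x => x ^ (α - 1)) b,
      integral_rpow (Or.inl (by linarith)), Real.Gamma_add_one (by linarith)]
    simp only [sub_self, sub_add_cancel, intervalIntegral.integral_const, smul_eq_mul, mul_one]
    rw [Real.zero_rpow (by linarith), sub_zero, div_div]
  rw [← hint]
  apply intervalIntegral.integral_mono_on hab.le
  · simp only [hgreen]
    apply Continuous.intervalIntegrable
    fun_prop
  · apply Continuous.intervalIntegrable
    fun_prop
  · intro s hs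
    rw [hgreen]
    have hp : 0 ≤ (t - a) ^ (2 - α) * ((max (t - s) 0) ^ (α - 1) / Real.Gamma α) := by
      positivity
    have hq : 0 ≤ (b - s) ^ (α - 1) / Real.Gamma α + 1 := by
      have : 0 ≤ (b - s) ^ (α - 1) := Real.rpow_nonneg (by linarith [hs.2]) _
      positivity
    calc _ = (t - a) ^ (2 - α) * ((t - a) ^ (α - 1) + (α - 1) * (t - a) ^ (α - 2)) / A *
          ((b - s) ^ (α - 1) / Real.Gamma α + 1)
          - (t - a) ^ (2 - α) * ((max (t - s) 0) ^ (α - 1) / Real.Gamma α) := by ring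
      _ ≤ (t - a + (α - 1)) / A * ((b - s) ^ (α - 1) / Real.Gamma α + 1) := by
          rw [hmul]; linarith
      _ ≤ _ := by
          apply mul_le_mul_of_nonneg_right _ hq
          apply div_le_div_of_nonneg_right _ hA.le
          linarith
end

section
/- Let 1 < α ≤ 2 and let x be a real number with |x| ≤ (α−1)(α+Γ(α))Γ(α) / (α(1+Γ(α))). Then E_α(x) + (1−x) E_{α,α}(x) + E_{α,α−1}(x) ≠ 0. -/
open Real Set Filter MeasureTheory

lemma aux_fact (n : ℕ) : 2^n ≤ (n+1).factorial := by
  induction n with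
  | zero => simp
  | succ m ih =>
    rw [Nat.factorial_succ, pow_succ, mul_comm]
    exact Nat.mul_le_mul (by omega) ih

lemma aux_Gamma_ge {t : ℝ} (n : ℕ) (ht : (n:ℝ) + 2 ≤ t) : (2:ℝ)^n ≤ Real.Gamma t := by
  have h1 : Real.Gamma ((n:ℝ)+2) ≤ Real.Gamma t := by
    have h0 : (0:ℝ) ≤ n := Nat.cast_nonneg n
    exact Real.Gamma_strictMonoOn_Ici.monotoneOn (by simp only [Set.mem_Ici]; linarith)
      (by simp only [Set.mem_Ici]; linarith) ht
  have h2 : Real.Gamma ((n:ℝ)+2) = ((n+1).factorial : ℝ) := by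
    rw [← Real.Gamma_nat_eq_factorial]; push_cast; ring_nf
  have h3 := aux_fact n
  rw [h2] at h1
  refine le_trans ?_ h1
  exact_mod_cast h3

lemma aux_Gamma_le_one {a : ℝ} (h1 : 1 < a) (h2 : a ≤ 2) : Real.Gamma a ≤ 1 := by
  have h := Real.convexOn_Gamma.2 (show (1:ℝ) ∈ Set.Ioi 0 by simp) (show (2:ℝ) ∈ Set.Ioi 0 by simp)
    (show 0 ≤ 2 - a by linarith) (show 0 ≤ a - 1 by linarith) (by ring)
  simp only [smul_eq_mul, Real.Gamma_one, Real.Gamma_two] at h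
  have e : (2 - a) * 1 + (a - 1) * 2 = a := by ring
  rw [e] at h
  linarith

lemma aux_summable {α β x : ℝ} (hα : 1 < α) (hβ : 0 < β) (hx : |x| < 1) :
    Summable (fun k : ℕ => x ^ k / Real.Gamma (k * α + β)) := by
  rw [← summable_nat_add_iff 2]
  have hg : Summable (fun k : ℕ => |x| ^ (k+2)) :=
    (summable_nat_add_iff 2).2 (summable_geometric_of_lt_one (abs_nonneg x) hx)
  refine Summable.of_norm_bounded hg ?_
  intro k
  have hk : (0:ℝ) ≤ k := Nat.cast_nonneg k
  have h : (1:ℝ) ≤ Real.Gamma (((k+2 : ℕ):ℝ) * α + β) := by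
    have := aux_Gamma_ge (t := ((k+2 : ℕ):ℝ) * α + β) 0 (by push_cast; nlinarith)
    simpa using this
  rw [norm_div, norm_pow, Real.norm_eq_abs, Real.norm_eq_abs, abs_of_pos (a := Real.Gamma _) (by linarith)]
  exact div_le_self (by positivity) h

lemma aux_coef {α : ℝ} (hα : 1 < α) (k : ℕ) :
    |1 / Real.Gamma (((k+2 : ℕ):ℝ) * α + 1) + 1 / Real.Gamma (((k+2 : ℕ):ℝ) * α + α)
      + 1 / Real.Gamma (((k+2 : ℕ):ℝ) * α + (α - 1)) - 1 / Real.Gamma (((k+1 : ℕ):ℝ) * α + α)|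
      ≤ 3 / 2 * (1/2)^k := by
  have hk : (0:ℝ) ≤ k := Nat.cast_nonneg k
  have e : ((k+1 : ℕ):ℝ) * α + α = ((k+2 : ℕ):ℝ) * α := by push_cast; ring
  rw [e]
  obtain ⟨t, ht⟩ : ∃ t, t = ((k+2 : ℕ):ℝ) * α := ⟨_, rfl⟩
  rw [← ht]
  have htk : (k:ℝ) + 2 ≤ t := by rw [ht]; push_cast; nlinarith
  have e2 : t + α = (t + (α - 1)) + 1 := by ring
  obtain ⟨s, hs⟩ : ∃ s, s = t + (α - 1) := ⟨_, rfl⟩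
  have hsk : (k:ℝ) + 2 ≤ s := by rw [hs]; linarith
  rw [e2, ← hs, Real.Gamma_add_one (by linarith : t ≠ 0) , Real.Gamma_add_one (by linarith : s ≠ 0)]
  have g1 := aux_Gamma_ge k htk
  have g2 := aux_Gamma_ge k hsk
  have hp : (0:ℝ) < 2^k := by positivity
  have i1 : 1 / Real.Gamma t ≤ (1/2)^k := by
    rw [one_div_pow]; exact one_div_le_one_div_of_le hp g1
  have i2 : 1 / Real.Gamma s ≤ (1/2)^k := by
    rw [one_div_pow]; exact one_div_le_one_div_of_le hp g2
  have p1 : 0 < 1 / Real.Gamma t := by apply one_div_pos.2; linarith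
  have p2 : 0 < 1 / Real.Gamma s := by apply one_div_pos.2; linarith
  have j1 : 1 / (t * Real.Gamma t) = (1/t) * (1 / Real.Gamma t) := by rw [one_div_mul_one_div]
  have j2 : 1 / (s * Real.Gamma s) = (1/s) * (1 / Real.Gamma s) := by rw [one_div_mul_one_div]
  have q1 : 0 < 1 / t := by apply one_div_pos.2; linarith
  have q2 : 0 < 1 / s := by apply one_div_pos.2; linarith
  have r1 : 1 / t ≤ 1/2 := one_div_le_one_div_of_le (by norm_num) (by linarith)
  have r2 : 1 / s ≤ 1/2 := one_div_le_one_div_of_le (by norm_num) (by linarith)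
  rw [j1, j2, abs_le]
  have m1 := mul_pos q1 p1
  have m2 := mul_pos q2 p2
  have n1 := mul_le_mul_of_nonneg_right r1 p1.le
  have n2 := mul_le_mul_of_nonneg_right r2 p2.le
  constructor <;> linarith

theorem stmt8 (α x : ℝ) (hα1 : 1 < α) (hα2 : α ≤ 2)
    (hx : |x| ≤ (α - 1) * (α + Real.Gamma α) * Real.Gamma α / (α * (1 + Real.Gamma α))) :
    ML α 1 x + (1 - x) * ML α α x + ML α (α - 1) x ≠ 0 := by
  have hG1 := aux_Gamma_le_one hα1 hα2
  have hG0 : 0 < Real.Gamma α := Real.Gamma_pos_of_pos (by linarith)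
  have hxb : |x| ≤ (α^2 - 1) / (2 * α) := by
    refine hx.trans ?_
    rw [div_le_div_iff₀ (by positivity) (by positivity)]
    clear hx
    generalize Real.Gamma α = G at *
    have : 0 ≤ (α * (α - 1)) * ((1 - G) * (α + 1 + 2 * G)) := by
      apply mul_nonneg
      · apply mul_nonneg <;> linarith
      · apply mul_nonneg <;> linarith
    linarith
  have hax : α * |x| ≤ (α^2-1)/2 := by
    rw [le_div_iff₀ (by linarith)] at hxb
    linarith
  have hx34 : |x| ≤ 3/4 := by
    by_contra hcon
    push Not at hcon
    nlinarith
  have hx1 : |x| < 1 := by linarith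
  have s1 := aux_summable hα1 (by norm_num : (0:ℝ) < 1) hx1
  have s2 := aux_summable hα1 (by linarith : (0:ℝ) < α) hx1
  have s3 := aux_summable hα1 (by linarith : (0:ℝ) < α - 1) hx1
  apply ne_of_gt
  rcases le_or_gt 0 x with h0 | h0
  · have hx1' : x < 1 := (le_abs_self x).trans_lt hx1
    have nn : ∀ β : ℝ, 0 < β → ∀ k : ℕ, 0 ≤ x ^ k / Real.Gamma (k * α + β) := by
      intro β hβ k
      have : 0 < Real.Gamma (k * α + β) := Real.Gamma_pos_of_pos (by positivity)
      positivity
    have t1 : 1 ≤ ML α 1 x := by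
      have := s1.le_tsum 0 (fun j _ => nn 1 one_pos j)
      simpa [ML] using this
    have t2 : 0 ≤ ML α α x := tsum_nonneg (nn α (by linarith))
    have t3 : 0 ≤ ML α (α - 1) x := tsum_nonneg (nn (α-1) (by linarith))
    have := mul_nonneg (by linarith : 0 ≤ 1 - x) t2
    linarith
  · have f1 := s1.sum_add_tsum_nat_add 2
    have f2 := s2.sum_add_tsum_nat_add 2
    have f3 := s3.sum_add_tsum_nat_add 2
    have f4 := s2.sum_add_tsum_nat_add 1
    have u1 := (summable_nat_add_iff 2).2 s1
    have u2 := (summable_nat_add_iff 2).2 s2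
    have u3 := (summable_nat_add_iff 2).2 s3
    have u4 := ((summable_nat_add_iff 1).2 s2).mul_left x
    have hR := ((((u1.hasSum.add u2.hasSum).add u3.hasSum).sub u4.hasSum))
    rw [tsum_mul_left] at hR
    have y0 : 0 < |x| := abs_pos.2 h0.ne
    have hgs : HasSum (fun k : ℕ => 3/2 * |x|^2 * (|x|/2)^k) (3/2 * |x|^2 * (1 - |x|/2)⁻¹) :=
      (hasSum_geometric_of_lt_one (by positivity) (by linarith)).mul_left _
    have hRb := tsum_of_norm_bounded (f := fun k : ℕ => x ^ (k+2) / Real.Gamma (((k+2 : ℕ):ℝ) * α + 1) + x ^ (k+2) / Real.Gamma (((k+2 : ℕ):ℝ) * α + α)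
      + x ^ (k+2) / Real.Gamma (((k+2 : ℕ):ℝ) * α + (α - 1)) - x * (x ^ (k+1) / Real.Gamma (((k+1 : ℕ):ℝ) * α + α))) hgs (by
      intro k
      have := mul_le_mul_of_nonneg_left (aux_coef hα1 k) (by positivity : 0 ≤ |x|^(k+2))
      rw [← abs_pow, ← abs_mul, abs_pow] at this
      rw [Real.norm_eq_abs]
      refine le_trans (le_of_eq ?_) (this.trans (le_of_eq ?_))
      · congr 1; ring
      · rw [div_pow |x|, one_div_pow]; ring)
    rw [hR.tsum_eq, Real.norm_eq_abs] at hRb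
    have hRl := neg_le_of_abs_le hRb
    change 0 < (∑' k : ℕ, x ^ k / Real.Gamma (k * α + 1)) + (1 - x) * (∑' k : ℕ, x ^ k / Real.Gamma (k * α + α)) + (∑' k : ℕ, x ^ k / Real.Gamma (k * α + (α - 1)))
    simp only [Finset.sum_range_succ, Finset.sum_range_zero, Nat.cast_zero, Nat.cast_one, pow_zero, pow_one,
      zero_mul, zero_add, one_mul, Real.Gamma_one] at f1 f2 f3 f4
    have c0 : 1 + α ≤ 1 + 1 / Real.Gamma α + 1 / Real.Gamma (α - 1) := by
      have e := Real.Gamma_add_one (by linarith : α - 1 ≠ 0)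
      rw [sub_add_cancel] at e
      have hp : 0 < Real.Gamma (α - 1) := Real.Gamma_pos_of_pos (by linarith)
      have a1 : 1 ≤ 1 / Real.Gamma α := by rw [le_div_iff₀ hG0]; linarith
      have a2 : α - 1 ≤ 1 / Real.Gamma (α - 1) := by rw [le_div_iff₀ hp]; linarith
      linarith
    have hp2 : 0 < Real.Gamma (α + α) := Real.Gamma_pos_of_pos (by linarith)
    have c1 : 1 / Real.Gamma (α + 1) + 1 / Real.Gamma (α + α) + 1 / Real.Gamma (α + (α - 1)) - 1 / Real.Gamma α
        ≤ 2 * α / Real.Gamma (α + α) := by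
      have a1 : 1 / Real.Gamma (α + 1) ≤ 1 / Real.Gamma α := by
        rw [Real.Gamma_add_one (by linarith)]
        apply one_div_le_one_div_of_le hG0
        nlinarith
      have a2 : 1 / Real.Gamma (α + (α - 1)) = (2 * α - 1) / Real.Gamma (α + α) := by
        have e := Real.Gamma_add_one (by linarith : α + (α - 1) ≠ 0)
        rw [show α + (α - 1) + 1 = α + α by ring] at e
        have hp : 0 < Real.Gamma (α + (α - 1)) := Real.Gamma_pos_of_pos (by linarith)
        rw [e, div_eq_div_iff hp.ne' (mul_pos (by linarith) hp).ne']
        ring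
      rw [a2]
      have : 2 * α / Real.Gamma (α + α) = 1 / Real.Gamma (α + α) + (2 * α - 1) / Real.Gamma (α + α) := by
        rw [← add_div]; ring
      linarith
    have c1y := mul_le_mul_of_nonneg_left c1 y0.le
    have habs : |x| = -x := abs_of_neg h0
    have key : |x| * (2 * α / Real.Gamma (α + α)) + 3/2 * |x|^2 * (1 - |x|/2)⁻¹ < 1 + α := by
      clear hR hRb hRl hgs c1y habs hx hxb
      generalize |x| = y at *
      rcases le_or_gt (3/2) α with ha | ha
      · have g := aux_Gamma_ge (t := α + α) 1 (by push_cast; linarith)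
        have b1 : 2 * α / Real.Gamma (α + α) ≤ α := by
          rw [div_le_iff₀ hp2]; nlinarith
        have b2 : (1 - y/2)⁻¹ ≤ 8/5 := by
          rw [inv_le_comm₀ (by linarith) (by norm_num)]; norm_num; linarith
        have b3 : 3/2 * y^2 * (1 - y/2)⁻¹ ≤ 3/2 * (3/4)^2 * (8/5) := by gcongr; exact inv_nonneg.2 (by linarith)
        nlinarith
      · have g := aux_Gamma_ge (t := α + α) 0 (by push_cast; linarith)
        have b1 : 2 * α / Real.Gamma (α + α) ≤ 2 * α := by
          rw [div_le_iff₀ hp2]; nlinarith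
        have hy2 : y ≤ 1/2 := by
          by_contra hcon
          push Not at hcon
          nlinarith
        have b2 : (1 - y/2)⁻¹ ≤ 4/3 := by
          rw [inv_le_comm₀ (by linarith) (by norm_num)]; norm_num; linarith
        have b3 : 3/2 * y^2 * (1 - y/2)⁻¹ ≤ 3/2 * (1/2)^2 * (4/3) := by gcongr; exact inv_nonneg.2 (by linarith)
        nlinarith
    rw [habs] at c1y key hRl
    have f4' := congrArg (fun z => x * z) f4
    beta_reduce at f4'
    rw [sub_mul, one_mul]
    simp only [div_eq_mul_inv, one_mul, inv_one, mul_one] at *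
    rw [← f4', ← f1, ← f2, ← f3]
    linarith
end

section
/- Let a < b be real numbers and let 1 < α < 2. Fix t ∈ (a,b]. Then the function s ↦ G(t,s) is strictly decreasing on the interval [t,b]: for t ≤ s₁ < s₂ ≤ b one has G(t,s₁) > G(t,s₂). -/
open Real Set Filter MeasureTheory

theorem stmt13 (a b α : ℝ) (hab : a < b) (hα1 : 1 < α) (hα2 : α < 2)
    (t : ℝ) (ht : t ∈ Set.Ioc a b) :
    ∀ s₁ s₂ : ℝ, t ≤ s₁ → s₁ < s₂ → s₂ ≤ b →
      greenG a b α t s₂ < greenG a b α t s₁ := by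
  intro s₁ s₂ h1 h12 h2
  have hta : 0 < t - a := sub_pos.mpr ht.1
  have hba : 0 < b - a := sub_pos.mpr hab
  have hα : 0 < α - 1 := sub_pos.mpr hα1
  have hG : 0 < Real.Gamma α := Real.Gamma_pos_of_pos (by linarith)
  have hC : 0 < ((t - a) ^ (α - 1) + (α - 1) * (t - a) ^ (α - 2)) /
      ((b - a) ^ (α - 1) + (α - 1) * (b - a) ^ (α - 2) + Real.Gamma α) := by
    have e1 := Real.rpow_pos_of_pos hta (α - 1)
    have e2 := Real.rpow_pos_of_pos hta (α - 2)
    have e3 := Real.rpow_pos_of_pos hba (α - 1)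
    have e4 := Real.rpow_pos_of_pos hba (α - 2)
    positivity
  have hlt : (b - s₂) ^ (α - 1) < (b - s₁) ^ (α - 1) :=
    Real.rpow_lt_rpow (by linarith) (by linarith) hα
  have hdiv := div_lt_div_of_pos_right hlt hG
  unfold greenG
  rw [if_pos (h1.trans h12.le), if_pos h1]
  exact mul_lt_mul_of_pos_left (by linarith) hC
end

section
/- Let a < b be real numbers and let 1 < α < 2. Fix t ∈ (a,b]. Then the function s ↦ G(t,s) is strictly increasing on the interval (a,t]: for a < s₁ < s₂ ≤ t one has G(t,s₁) < G(t,s₂). -/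
open Real Set Filter MeasureTheory

/-- The pointwise inequality behind the sign of the derivative. -/
lemma green_key (a b α t s : ℝ) (hα1 : 1 < α) (hα2 : α < 2) (hs : a < s) (hst : s < t)
    (htb : t ≤ b) :
    ((t - a) ^ (α - 1) + (α - 1) * (t - a) ^ (α - 2)) /
        ((b - a) ^ (α - 1) + (α - 1) * (b - a) ^ (α - 2) + Real.Gamma α) *
      (b - s) ^ (α - 2) < (t - s) ^ (α - 2) := by
  have hG : 0 < Real.Gamma α := Real.Gamma_pos_of_pos (by linarith)
  have fx : ∀ x : ℝ, 0 < x → x ^ (α - 1) + (α - 1) * x ^ (α - 2) = x ^ (α - 2) * (x + (α - 1)) := by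
    intro x hx
    have : x ^ (α - 1) = x ^ (α - 2) * x := by
      rw [← Real.rpow_add_one hx.ne']
      congr 1
      ring
    rw [this]
    ring
  have hta : 0 < t - a := by linarith
  have hba : 0 < b - a := by linarith
  have hbs : 0 < b - s := by linarith
  have hts : 0 < t - s := by linarith
  rw [fx _ hta, fx _ hba, div_mul_eq_mul_div]
  have p1 := Real.rpow_pos_of_pos hta (α - 2)
  have p2 := Real.rpow_pos_of_pos hba (α - 2)
  have p3 := Real.rpow_pos_of_pos hbs (α - 2)
  have p4 := Real.rpow_pos_of_pos hts (α - 2)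
  rw [div_lt_iff₀ (by have := mul_pos p2 (by linarith : 0 < b - a + (α - 1)); linarith)]
  have h1 : (t - a) ^ (α - 2) * (b - s) ^ (α - 2) ≤ (t - s) ^ (α - 2) * (b - a) ^ (α - 2) := by
    rw [← Real.mul_rpow hta.le hbs.le, ← Real.mul_rpow hts.le hba.le]
    apply Real.rpow_le_rpow_of_nonpos (by positivity) _ (by linarith)
    nlinarith [mul_nonneg (sub_nonneg.2 htb) (sub_nonneg.2 hs.le)]
  calc (t - a) ^ (α - 2) * (t - a + (α - 1)) * (b - s) ^ (α - 2)
      = ((t - a) ^ (α - 2) * (b - s) ^ (α - 2)) * (t - a + (α - 1)) := by ring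
    _ ≤ ((t - s) ^ (α - 2) * (b - a) ^ (α - 2)) * (b - a + (α - 1)) := by
        apply mul_le_mul h1 (by linarith) (by linarith) (by positivity)
    _ < _ := by nlinarith [mul_pos p4 hG]

theorem stmt14 (a b α : ℝ) (hab : a < b) (hα1 : 1 < α) (hα2 : α < 2)
    (t : ℝ) (ht : t ∈ Set.Ioc a b) :
    ∀ s₁ s₂ : ℝ, a < s₁ → s₁ < s₂ → s₂ ≤ t →
      greenG a b α t s₁ < greenG a b α t s₂ := by
  intro s₁ s₂ h1 h12 h2
  have hG : 0 < Real.Gamma α := Real.Gamma_pos_of_pos (by linarith)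
  have key := fun s hs hst => green_key a b α t s hα1 hα2 hs hst ht.2
  have hval : ∀ s, s ≤ t → greenG a b α t s =
      ((t - a) ^ (α - 1) + (α - 1) * (t - a) ^ (α - 2)) /
        ((b - a) ^ (α - 1) + (α - 1) * (b - a) ^ (α - 2) + Real.Gamma α) *
      ((b - s) ^ (α - 1) / Real.Gamma α + 1) - (t - s) ^ (α - 1) / Real.Gamma α := by
    intro s hs
    unfold greenG
    split_ifs with h
    · have : s = t := le_antisymm hs h
      subst this
      rw [sub_self, Real.zero_rpow (by linarith)]
      simp
    · rfl
  rw [hval s₁ (by linarith), hval s₂ h2]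
  set C := ((t - a) ^ (α - 1) + (α - 1) * (t - a) ^ (α - 2)) /
        ((b - a) ^ (α - 1) + (α - 1) * (b - a) ^ (α - 2) + Real.Gamma α)
  have hanti : StrictAntiOn (fun s : ℝ => (t - s) ^ (α - 1) - C * (b - s) ^ (α - 1)) (Icc a t) := by
    apply strictAntiOn_of_deriv_neg (convex_Icc a t)
    · apply ContinuousOn.sub
      · exact ContinuousOn.rpow_const (by fun_prop) (fun x _ => Or.inr (by linarith))
      · exact continuousOn_const.mul
          (ContinuousOn.rpow_const (by fun_prop) (fun x _ => Or.inr (by linarith)))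
    · intro s hs
      rw [interior_Icc] at hs
      have d : ∀ c : ℝ, s < c → HasDerivAt (fun s : ℝ => (c - s) ^ (α - 1))
          (-1 * (α - 1) * (c - s) ^ (α - 1 - 1)) s := by
        intro c hc
        exact ((hasDerivAt_id s).const_sub c).rpow_const (Or.inl (sub_pos.2 hc).ne')
      have hd := (d t hs.2).sub ((d b (lt_of_lt_of_le hs.2 ht.2)).const_mul C)
      have e : α - 1 - 1 = α - 2 := by ring
      have hk := key s hs.1 hs.2
      rw [e] at hd
      have hd' := hd.deriv
      refine lt_of_eq_of_lt hd' ?_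
      nlinarith [mul_pos (sub_pos.2 hα1) (sub_pos.2 hk)]
  have := hanti ⟨h1.le, by linarith⟩ ⟨by linarith, h2⟩ h12
  have h3 := div_lt_div_of_pos_right this hG
  simp only [sub_div, mul_div_assoc] at h3
  linarith
end

section
/- Let 1 < α ≤ 2, λ ∈ ℝ, and define g(t) = t^{α−1} E_{α,α}(−λ t^α) for t > 0. Then for every t > 0, g is differentiable at t and g'(t) = t^{α−2} E_{α,α−1}(−λ t^α). -/
open Real Set Filter MeasureTheory

theorem ml_summable (α β x : ℝ) (hα : 1 < α) (hβ : 0 < β) :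
    Summable (fun k : ℕ => x ^ k / Real.Gamma (k * α + β)) := by
  rw [← summable_nat_add_iff 2]
  refine Summable.of_norm_bounded ((Real.summable_pow_div_factorial |x|).mul_left (|x| ^ 2)) ?_
  intro k
  have hk : (0 : ℝ) ≤ k := Nat.cast_nonneg k
  have harg : (k : ℝ) + 1 + 1 ≤ ((k + 2 : ℕ) : ℝ) * α + β := by
    push_cast
    nlinarith
  have hG : ((k + 1).factorial : ℝ) ≤ Real.Gamma (((k + 2 : ℕ) : ℝ) * α + β) := by
    have h1 := Real.Gamma_nat_eq_factorial (k + 1)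
    push_cast at h1
    rw [← h1]
    apply Real.Gamma_strictMonoOn_Ici.monotoneOn _ _ harg
    · simp only [Set.mem_Ici]; linarith
    · simp only [Set.mem_Ici]; linarith
  have hf : ((k).factorial : ℝ) ≤ ((k + 1).factorial : ℝ) := by
    exact_mod_cast Nat.factorial_le (Nat.le_succ k)
  have hp : (0 : ℝ) < (k.factorial : ℝ) := by exact_mod_cast Nat.factorial_pos k
  have hGp : 0 < Real.Gamma (((k + 2 : ℕ) : ℝ) * α + β) := by linarith
  rw [norm_div, norm_pow, Real.norm_eq_abs, Real.norm_eq_abs, abs_of_pos hGp, ← mul_div_assoc,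
    ← pow_add, add_comm 2 k]
  gcongr
  linarith

theorem ml_term_deriv (α lam : ℝ) (hα1 : 1 < α) (k : ℕ) (y : ℝ) (hy : 0 < y) :
    HasDerivAt (fun t : ℝ => t ^ (α - 1) * ((-lam * t ^ α) ^ k / Real.Gamma (k * α + α)))
      (y ^ (α - 2) * ((-lam * y ^ α) ^ k / Real.Gamma (k * α + (α - 1)))) y := by
  have hk : (0 : ℝ) ≤ k := Nat.cast_nonneg k
  have hc : 0 < (k : ℝ) * α + (α - 1) := by nlinarith [mul_nonneg hk (by linarith : (0:ℝ) ≤ α)]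
  have key : ∀ z : ℝ, 0 < z → ∀ b : ℝ,
      z ^ b * (-lam * z ^ α) ^ k = (-lam) ^ k * z ^ (k * α + b) := by
    intro z hz b
    rw [mul_pow, ← Real.rpow_natCast (z ^ α) k, ← Real.rpow_mul hz.le, Real.rpow_add hz,
      mul_comm α]
    ring
  have hG : Real.Gamma (k * α + α) = (k * α + (α - 1)) * Real.Gamma (k * α + (α - 1)) := by
    rw [← Real.Gamma_add_one hc.ne']
    congr 1
    ring
  have hGp := Real.Gamma_pos_of_pos hc
  have h := ((Real.hasDerivAt_rpow_const (x := y) (p := k * α + (α - 1))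
    (Or.inl hy.ne')).const_mul ((-lam) ^ k)).div_const (Real.Gamma (k * α + α))
  have h2 := h.congr_of_eventuallyEq
    (f₁ := fun t : ℝ => t ^ (α - 1) * ((-lam * t ^ α) ^ k / Real.Gamma (k * α + α))) (by
      filter_upwards [lt_mem_nhds hy] with z hz
      rw [← mul_div_assoc, key z hz])
  refine h2.congr_deriv (Eq.symm ?_)
  rw [← mul_div_assoc, key y hy, hG, show (k : ℝ) * α + (α - 1) - 1 = k * α + (α - 2) by ring]
  field_simp

theorem stmt15 (α lam : ℝ) (hα1 : 1 < α) (hα2 : α ≤ 2) :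
    ∀ t : ℝ, 0 < t →
      HasDerivAt (fun t : ℝ => t ^ (α - 1) * ML α α (-lam * t ^ α))
        (t ^ (α - 2) * ML α (α - 1) (-lam * t ^ α)) t := by
  intro t ht
  unfold ML
  simp only [← tsum_mul_left]
  have hmem : t ∈ Set.Ioo (t / 2) (2 * t) := ⟨by linarith, by linarith⟩
  refine hasDerivAt_tsum_of_isPreconnected (t := Set.Ioo (t / 2) (2 * t))
    (u := fun k : ℕ => (t / 2) ^ (α - 2) *
      ((|lam| * (2 * t) ^ α) ^ k / Real.Gamma (k * α + (α - 1))))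
    ((ml_summable α (α - 1) _ hα1 (by linarith)).mul_left _) isOpen_Ioo isPreconnected_Ioo
    (fun k y hy => ml_term_deriv α lam hα1 k y (by linarith [hy.1])) ?_ hmem
    ((ml_summable α α _ hα1 (by linarith)).mul_left _) hmem
  intro k y hy
  have hy0 : 0 < y := by linarith [hy.1]
  have hk : (0 : ℝ) ≤ k := Nat.cast_nonneg k
  have hc : 0 < (k : ℝ) * α + (α - 1) := by nlinarith [mul_nonneg hk (by linarith : (0:ℝ) ≤ α)]
  have hGp := Real.Gamma_pos_of_pos hc
  rw [norm_mul, norm_div, norm_pow, norm_mul, norm_neg, Real.norm_eq_abs, Real.norm_eq_abs,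
    Real.norm_eq_abs, Real.norm_eq_abs, abs_of_pos hGp, abs_of_pos (Real.rpow_pos_of_pos hy0 _),
    abs_of_pos (Real.rpow_pos_of_pos hy0 _)]
  have h1 : y ^ (α - 2) ≤ (t / 2) ^ (α - 2) :=
    Real.rpow_le_rpow_of_nonpos (by linarith) hy.1.le (by linarith)
  have h2 : y ^ α ≤ (2 * t) ^ α := Real.rpow_le_rpow hy0.le hy.2.le (by linarith)
  have h3 : 0 ≤ y ^ α := Real.rpow_nonneg hy0.le _
  have h4 : 0 ≤ (t / 2) ^ (α - 2) := Real.rpow_nonneg (by linarith) _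
  gcongr
end

section
/- Let 1 < α ≤ 2, λ ∈ ℝ, and define h(t) = t^{α−2} E_{α,α−1}(−λ t^α) for t > 0. Then for every t > 0, I^{2−α}_0 h(t) = E_α(−λ t^α) and D^{α−1}_0 h(t) = −λ t^{α−1} E_{α,α}(−λ t^α). -/
open Real Set Filter MeasureTheory

theorem ml_deriv_term (α : ℝ) (hα : 1 < α) (k : ℕ) (x : ℝ) :
    ((k + 1 : ℕ) : ℝ) * x ^ k / Real.Gamma (((k + 1 : ℕ) : ℝ) * α + 1) =
      1 / α * (x ^ k / Real.Gamma (k * α + α)) := by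
  have hp : (0 : ℝ) < k * α + α := by positivity
  have e : ((k + 1 : ℕ) : ℝ) * α = k * α + α := by push_cast; ring
  rw [e, Real.Gamma_add_one hp.ne']
  have := (Real.Gamma_pos_of_pos hp).ne'
  have hk : ((k : ℝ) + 1) ≠ 0 := by positivity
  have e2 : (k : ℝ) * α + α = (k + 1) * α := by ring
  push_cast
  generalize Real.Gamma (k * α + α) = G at *
  rw [e2]
  field_simp

theorem ml_hasDerivAt (α : ℝ) (hα : 1 < α) (x : ℝ) :
    HasDerivAt (ML α 1) (1 / α * ML α α x) x := by
  have h0 : 0 < α := by linarith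
  set R : ℝ := |x| + 1
  have hu : Summable (fun n : ℕ => (n : ℝ) * R ^ (n - 1) / Real.Gamma (n * α + 1)) := by
    rw [← summable_nat_add_iff 1]
    refine ((ml_summable α α R hα h0).mul_left (1 / α)).congr ?_
    intro k
    exact (ml_deriv_term α hα k R).symm
  have key := hasDerivAt_tsum_of_isPreconnected (𝕜 := ℝ) (F := ℝ)
    (g := fun (n : ℕ) (y : ℝ) => y ^ n / Real.Gamma (n * α + 1))
    (g' := fun (n : ℕ) (y : ℝ) => (n : ℝ) * y ^ (n - 1) / Real.Gamma (n * α + 1))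
    (t := Metric.ball 0 R) (y₀ := x) (y := x)
    hu Metric.isOpen_ball (convex_ball _ _).isPreconnected
    (fun n y _ => (hasDerivAt_pow n y).div_const _)
    (by
      intro n y hy
      have hG : 0 < Real.Gamma (n * α + 1) := Real.Gamma_pos_of_pos (by positivity)
      rw [mem_ball_zero_iff] at hy
      rw [norm_div, norm_mul, norm_pow, Real.norm_of_nonneg hG.le,
        Real.norm_of_nonneg (Nat.cast_nonneg n)]
      gcongr)
    (by simp [R]) (ml_summable α 1 x hα one_pos) (by simp [R])
  have e : ∑' n : ℕ, (n : ℝ) * x ^ (n - 1) / Real.Gamma (n * α + 1) = 1 / α * ML α α x := by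
    have hs : Summable (fun n : ℕ => (n : ℝ) * x ^ (n - 1) / Real.Gamma (n * α + 1)) := by
      rw [← summable_nat_add_iff 1]
      refine ((ml_summable α α x hα h0).mul_left (1 / α)).congr ?_
      intro k
      exact (ml_deriv_term α hα k x).symm
    rw [hs.tsum_eq_zero_add, ML, ← tsum_mul_left]
    simp only [Nat.cast_zero, zero_mul, zero_div, zero_add, Nat.add_sub_cancel]
    exact tsum_congr fun k => ml_deriv_term α hα k x
  rw [e] at key
  exact key

theorem real_beta (u v t : ℝ) (hu : 0 < u) (hv : 0 < v) (ht : 0 < t) :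
    ∫ s in (0 : ℝ)..t, s ^ (u - 1) * (t - s) ^ (v - 1) =
      t ^ (u + v - 1) * (Real.Gamma u * Real.Gamma v / Real.Gamma (u + v)) := by
  have h := Complex.betaIntegral_scaled (u : ℂ) (v : ℂ) ht
  rw [Complex.betaIntegral_eq_Gamma_mul_div (u : ℂ) (v : ℂ) (by simpa) (by simpa)] at h
  have h2 : ∫ x in (0 : ℝ)..t, (x : ℂ) ^ ((u : ℂ) - 1) * ((t : ℂ) - x) ^ ((v : ℂ) - 1) =
      ((∫ s in (0 : ℝ)..t, s ^ (u - 1) * (t - s) ^ (v - 1) : ℝ) : ℂ) := by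
    rw [← intervalIntegral.integral_ofReal]
    refine intervalIntegral.integral_congr ?_
    intro s hs
    rw [uIcc_of_le ht.le] at hs
    have h1 : 0 ≤ t - s := by linarith [hs.2]
    simp only
    push_cast [Complex.ofReal_cpow hs.1, Complex.ofReal_cpow h1]
    rfl
  rw [h2, ← Complex.ofReal_add, Complex.Gamma_ofReal, Complex.Gamma_ofReal,
    Complex.Gamma_ofReal] at h
  have h3 : ((t : ℂ) ^ (((u + v : ℝ) : ℂ) - 1)) = ((t ^ (u + v - 1) : ℝ) : ℂ) := by
    rw [Complex.ofReal_cpow ht.le]; push_cast; rfl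
  rw [h3] at h
  exact_mod_cast h

theorem rlint_h (α lam : ℝ) (hα1 : 1 < α) (hα2 : α ≤ 2) (t : ℝ) (ht : 0 < t) :
    RLint 0 (2 - α) (fun t : ℝ => t ^ (α - 2) * ML α (α - 1) (-lam * t ^ α)) t =
        ML α 1 (-lam * t ^ α) := by
  rcases hα2.eq_or_lt with rfl | hlt
  · unfold RLint
    norm_num
  have hv : 0 < 2 - α := by linarith
  have hu : ∀ k : ℕ, 0 < (k : ℝ) * α + (α - 1) := fun k => by
    have : (0 : ℝ) ≤ k * α := by positivity
    linarith
  have hGv := Real.Gamma_pos_of_pos hv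
  have hGu : ∀ k : ℕ, 0 < Real.Gamma ((k : ℝ) * α + (α - 1)) :=
    fun k => Real.Gamma_pos_of_pos (hu k)
  have hG1 : ∀ k : ℕ, 0 < Real.Gamma ((k : ℝ) * α + 1) :=
    fun k => Real.Gamma_pos_of_pos (by positivity)
  have hpow : ∀ (s : ℝ), 0 < s → ∀ k : ℕ, (s ^ α) ^ k = s ^ ((k : ℝ) * α) := by
    intro s hs k
    rw [← Real.rpow_natCast, ← Real.rpow_mul hs.le, mul_comm]
  have hI : ∀ k : ℕ, ∫ s in (0 : ℝ)..t, s ^ ((k : ℝ) * α + (α - 1) - 1) * (t - s) ^ (2 - α - 1) =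
      (t ^ α) ^ k *
        (Real.Gamma ((k : ℝ) * α + (α - 1)) * Real.Gamma (2 - α) / Real.Gamma (k * α + 1)) := by
    intro k
    rw [real_beta _ _ t (hu k) hv ht, hpow t ht,
      show (k : ℝ) * α + (α - 1) + (2 - α) = k * α + 1 by ring, add_sub_cancel_right]
  have hInt : ∀ k : ℕ, IntervalIntegrable
      (fun s : ℝ => s ^ ((k : ℝ) * α + (α - 1) - 1) * (t - s) ^ (2 - α - 1)) volume 0 t := by
    intro k
    apply intervalIntegral.intervalIntegrable_of_integral_ne_zero
    rw [hI]
    have := hGu k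
    have := hG1 k
    positivity
  set F : ℕ → ℝ → ℝ := fun k s => (-lam) ^ k / Real.Gamma ((k : ℝ) * α + (α - 1)) *
    (s ^ ((k : ℝ) * α + (α - 1) - 1) * (t - s) ^ (2 - α - 1)) with hF
  have hFint : ∀ (c : ℝ) (k : ℕ), ∫ s in Ioc 0 t, c ^ k / Real.Gamma ((k : ℝ) * α + (α - 1)) *
      (s ^ ((k : ℝ) * α + (α - 1) - 1) * (t - s) ^ (2 - α - 1)) =
      Real.Gamma (2 - α) * ((c * t ^ α) ^ k / Real.Gamma (k * α + 1)) := by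
    intro c k
    rw [integral_const_mul, ← intervalIntegral.integral_of_le ht.le, hI, mul_pow]
    have := (hGu k).ne'
    have := (hG1 k).ne'
    field_simp
  have hsum := hasSum_integral_of_summable_integral_norm (μ := volume.restrict (Ioc 0 t)) (F := F)
    (fun k => ((intervalIntegrable_iff_integrableOn_Ioc_of_le ht.le).1 (hInt k)).const_mul _)
    (by
      refine ((ml_summable α 1 (|lam| * t ^ α) hα1 one_pos).mul_left
        (Real.Gamma (2 - α))).congr ?_
      intro k
      rw [← hFint |lam| k]
      refine setIntegral_congr_fun measurableSet_Ioc ?_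
      intro s hs
      have h1 : 0 ≤ t - s := by linarith [hs.2]
      have h2 : 0 ≤ s := hs.1.le
      simp only [hF]
      rw [norm_mul, norm_div, norm_pow, norm_neg, Real.norm_of_nonneg (hGu k).le,
        Real.norm_eq_abs lam, Real.norm_of_nonneg (by positivity)])
  have hval : ∫ s in (0 : ℝ)..t, (t - s) ^ (2 - α - 1) *
      (s ^ (α - 2) * ML α (α - 1) (-lam * s ^ α)) = ∫ s in Ioc 0 t, ∑' k, F k s := by
    rw [intervalIntegral.integral_of_le ht.le]
    refine setIntegral_congr_fun measurableSet_Ioc ?_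
    intro s hs
    simp only [ML, hF]
    rw [← tsum_mul_left, ← tsum_mul_left]
    refine tsum_congr fun k => ?_
    rw [mul_pow, hpow s hs.1, show (k : ℝ) * α + (α - 1) - 1 = (α - 2) + k * α by ring,
      Real.rpow_add hs.1]
    ring
  have hfin : ∑' k, ∫ s in Ioc 0 t, F k s = Real.Gamma (2 - α) * ML α 1 (-lam * t ^ α) := by
    rw [ML, ← tsum_mul_left]
    exact tsum_congr fun k => hFint (-lam) k
  unfold RLint
  rw [if_neg hv.ne']
  simp only
  rw [hval, ← hsum.tsum_eq, hfin]
  field_simp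

theorem stmt18 (α lam : ℝ) (hα1 : 1 < α) (hα2 : α ≤ 2) :
    ∀ t : ℝ, 0 < t →
      RLint 0 (2 - α) (fun t : ℝ => t ^ (α - 2) * ML α (α - 1) (-lam * t ^ α)) t =
        ML α 1 (-lam * t ^ α) ∧
      RLderivLow 0 (α - 1) (fun t : ℝ => t ^ (α - 2) * ML α (α - 1) (-lam * t ^ α)) t =
        -lam * t ^ (α - 1) * ML α α (-lam * t ^ α) := by
  intro t ht
  refine ⟨rlint_h α lam hα1 hα2 t ht, ?_⟩
  unfold RLderivLow
  rw [show 1 - (α - 1) = 2 - α by ring]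
  have hE : RLint 0 (2 - α) (fun t : ℝ => t ^ (α - 2) * ML α (α - 1) (-lam * t ^ α))
      =ᶠ[nhds t] fun t => ML α 1 (-lam * t ^ α) := by
    filter_upwards [lt_mem_nhds ht] with s hs
    exact rlint_h α lam hα1 hα2 s hs
  rw [hE.deriv_eq]
  have hd : HasDerivAt (fun t : ℝ => -lam * t ^ α) (-lam * (α * t ^ (α - 1))) t :=
    (Real.hasDerivAt_rpow_const (Or.inl ht.ne')).const_mul _
  have hc := (ml_hasDerivAt α hα1 (-lam * t ^ α)).comp t hd
  have := hc.deriv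
  simp only [Function.comp_def] at this
  rw [this]
  have : α ≠ 0 := by linarith
  field_simp
end
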